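/- Let H₁, H₂ be complex Hilbert spaces of finite dimensions d₁ ≥ d₂ > 1, H = H₁⊗H₂, d = d₁d₂, and fix k with 1 ≤ k ≤ d₂. Then the largest ball centered at 𝕀_H = I_H/d and contained in the convex hull Conv(E_k(H₁⊗H₂)) of the k-entangled pure states has radius 1/√(d(d−1)) and coincides with the largest ball centered at 𝕀_H contained in the set D(H) of all density states: every Hermitian operator A on H with tr(A) = 0 and Hilbert–Schmidt norm ‖A‖ ≤ 1/√(d(d−1)) satisfies 𝕀_H + A ∈ Conv(E_k(H₁⊗H₂)), and conversely any r such that {𝕀_H + A : tr(A) = 0, ‖A‖ ≤ r} ⊆ Conv(E_k(H₁⊗H₂)) satisfies r ≤ 1/√(d(d−1)). -/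

import Mathlib

open Matrix
open scoped Kronecker

noncomputable section

/-- The pure state (rank-one projection) `|ψ⟩⟨ψ|` associated with a vector `ψ`. -/
def pureState {n : Type*} [Fintype n] (ψ : n → ℂ) : Matrix n n ℂ :=
  Matrix.vecMulVec ψ (star ψ)

/-- `ψ` is a unit vector. -/
def IsUnitVec {n : Type*} [Fintype n] (ψ : n → ℂ) : Prop :=
  ∑ p, Complex.normSq (ψ p) = 1

/-- The Hilbert–Schmidt norm `‖A‖ = √tr(A²)` (of a Hermitian matrix `A`). -/
def hsNorm {n : Type*} [Fintype n] (A : Matrix n n ℂ) : ℝ :=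
  Real.sqrt ((A * A).trace.re)

/-- `ψ` has Schmidt rank at most `k`: it can be written as a sum of `k` simple tensors. -/
def SchmidtRankLE (d₁ d₂ k : ℕ) (ψ : Fin d₁ × Fin d₂ → ℂ) : Prop :=
  ∃ (α : Fin k → Fin d₁ → ℂ) (β : Fin k → Fin d₂ → ℂ),
    ∀ p, ψ p = ∑ j, α j p.1 * β j p.2

/-- `E_k(H₁ ⊗ H₂)`: the set of `k`-entangled pure states, i.e. pure states `P_ψ` of unit
vectors `ψ` of Schmidt rank `≤ k`. -/
def Ek (d₁ d₂ k : ℕ) : Set (Matrix (Fin d₁ × Fin d₂) (Fin d₁ × Fin d₂) ℂ) :=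
  {M | ∃ ψ : Fin d₁ × Fin d₂ → ℂ, IsUnitVec ψ ∧ SchmidtRankLE d₁ d₂ k ψ ∧ M = pureState ψ}

section
open scoped ComplexOrder

theorem Matrix.PosSemidef.norm_sq_apply_le {m : Type*} {N : Matrix m m ℂ} (hN : N.PosSemidef)
    (i j : m) :
    ‖N i j‖ ^ 2 ≤ (N i i).re * (N j j).re := by
  have hdet := (hN.submatrix ![i, j]).det_nonneg
  have hji : N j i = star (N i j) := (hN.isHermitian.apply j i).symm
  have hi : (N i i).im = 0 := by
    have := congrArg Complex.im (hN.isHermitian.apply i i)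
    simp at this; linarith
  rw [Matrix.det_fin_two] at hdet
  simp only [submatrix_apply, cons_val_zero, cons_val_one, hji] at hdet
  have h := (Complex.le_def.1 hdet).1
  simp [Complex.mul_re, hi] at h
  rw [Complex.sq_norm, Complex.normSq_apply]
  linarith

variable {m n : Type*} [Fintype m] [Fintype n]

theorem IsCompact.convexHull_of_finiteDimensional {E : Type*} [AddCommGroup E] [Module ℝ E]
    [TopologicalSpace E] [IsTopologicalAddGroup E] [ContinuousSMul ℝ E] [FiniteDimensional ℝ E]
    {K : Set E} (hK : IsCompact K) : IsCompact (convexHull ℝ K) := by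
  have key : convexHull ℝ K = (fun q : (Fin (Module.finrank ℝ E + 1) → ℝ) ×
      (Fin (Module.finrank ℝ E + 1) → E) => ∑ i, q.1 i • q.2 i) ''
      (stdSimplex ℝ (Fin (Module.finrank ℝ E + 1)) ×ˢ Set.univ.pi fun _ => K) := by
    apply Set.Subset.antisymm
    · intro x hx
      rw [convexHull_eq_union] at hx
      simp only [Set.mem_iUnion] at hx
      obtain ⟨t, htK, hai, hxt⟩ := hx
      have hne : t.Nonempty := by
        rw [← Finset.coe_nonempty, ← convexHull_nonempty_iff (𝕜 := ℝ)]; exact ⟨x, hxt⟩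
      have hcard : Fintype.card t ≤ Fintype.card (Fin (Module.finrank ℝ E + 1)) := by
        have := hai.card_le_finrank_succ
        have h3 := Submodule.finrank_le (vectorSpan ℝ (Set.range ((↑) : t → E)))
        rw [Fintype.card_fin]
        omega
      have : Nonempty t := hne.to_subtype
      obtain ⟨g⟩ := Function.Embedding.nonempty_of_card_le hcard
      set f := Function.invFun g with hf
      have hfs : Function.Surjective f := Function.invFun_surjective g.injective
      have hr : Set.range (fun i => (f i : E)) = (t : Set E) := by
        rw [← Function.comp_def, hfs.range_comp]; simp
      have hL : Set.range (fun i => (f i : E)) = Fintype.linearCombination ℝ (fun i => (f i : E)) ''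
          Set.range (fun i j => if i = j then (1 : ℝ) else 0) := by
        rw [← Set.range_comp]
        congr 1
        ext i
        simp [Fintype.linearCombination_apply]
      rw [← hr, hL, ← LinearMap.image_convexHull, convexHull_basis_eq_stdSimplex] at hxt
      obtain ⟨w, hw, rfl⟩ := hxt
      exact ⟨(w, fun i => f i), ⟨hw, fun i _ => htK (f i).2⟩, rfl⟩
    · rintro _ ⟨⟨w, y⟩, ⟨hw, hy⟩, rfl⟩
      exact (convex_convexHull ℝ K).sum_mem (fun i _ => hw.1 i) hw.2
        fun i _ => subset_convexHull ℝ K (hy i trivial)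
  rw [key]
  exact ((isCompact_stdSimplex ℝ _).prod (isCompact_univ_pi fun _ => hK)).image (by fun_prop)

section
open scoped Matrix.Norms.L2Operator MatrixOrder

theorem exists_spectral_resolution_of_mem_unitary [DecidableEq n] {U : Matrix n n ℂ}
    (hU : U ∈ unitary (Matrix n n ℂ)) :
    ∃ (s : Finset ℂ) (P : ℂ → Matrix n n ℂ), (∀ z ∈ s, ‖z‖ = 1) ∧ (∀ z, (P z).PosSemidef) ∧
      ∑ z ∈ s, P z = 1 ∧ ∑ z ∈ s, z • P z = U := by
  classical
  have hfin : (spectrum ℂ U).Finite := Matrix.finite_spectrum U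
  have hn : IsStarNormal U := isStarNormal_of_mem_unitary hU
  have hc (f : ℂ → ℂ) : ContinuousOn f (spectrum ℂ U) := hfin.continuousOn f
  refine ⟨hfin.toFinset, fun z => cfc (fun w => if w = z then (1 : ℂ) else 0) U, ?_, ?_, ?_, ?_⟩
  · intro z hz
    have := spectrum.subset_circle_of_unitary hU (hfin.mem_toFinset.1 hz)
    simpa using this
  · intro z
    rw [← Matrix.nonneg_iff_posSemidef]
    apply cfc_nonneg
    intro w _
    split_ifs <;> simp
  · rw [← cfc_sum _ _ _ fun i _ => hc _, ← cfc_one ℂ U]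
    apply cfc_congr
    intro w hw
    simp [hw]
  · simp_rw [← cfc_smul _ _ _ (hc _)]
    rw [← cfc_sum _ _ _ fun i _ => hc _]
    conv_rhs => rw [← cfc_id ℂ U]
    apply cfc_congr
    intro w hw
    simp [hw]

end

theorem norm_trace_mul_le_of_mem_unitary [DecidableEq n] {A B C U : Matrix n n ℂ}
    (hA : ∀ P : Matrix n n ℂ, P.PosSemidef → 0 ≤ (A * P).trace.re)
    (hC : ∀ P : Matrix n n ℂ, P.PosSemidef → 0 ≤ (C * P).trace.re)
    (hB : ∀ P : Matrix n n ℂ, P.PosSemidef →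
      ‖(B * P).trace‖ ^ 2 ≤ (A * P).trace.re * (C * P).trace.re)
    (hU : U ∈ unitary (Matrix n n ℂ)) :
    ‖(B * U).trace‖ ≤ √A.trace.re * √C.trace.re := by
  obtain ⟨s, P, hs, hP, h1, rfl⟩ := exists_spectral_resolution_of_mem_unitary hU
  have hsum (X : Matrix n n ℂ) : ∑ z ∈ s, (X * P z).trace.re = X.trace.re := by
    rw [← Complex.re_sum, ← Matrix.trace_sum, ← Finset.mul_sum, h1, mul_one]
  calc ‖(B * ∑ z ∈ s, z • P z).trace‖ = ‖∑ z ∈ s, z * (B * P z).trace‖ := by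
        simp [Finset.mul_sum, Matrix.trace_sum]
    _ ≤ ∑ z ∈ s, ‖(B * P z).trace‖ := by
        refine (norm_sum_le _ _).trans (Finset.sum_le_sum fun z hz => ?_)
        rw [norm_mul, hs z hz, one_mul]
    _ ≤ ∑ z ∈ s, √(A * P z).trace.re * √(C * P z).trace.re := by
        refine Finset.sum_le_sum fun z _ => ?_
        rw [← Real.sqrt_mul (hA _ (hP z))]
        exact Real.le_sqrt_of_sq_le (hB _ (hP z))
    _ ≤ √A.trace.re * √C.trace.re := by
        rw [← hsum A, ← hsum C]
        exact Real.sum_sqrt_mul_sqrt_le s (fun z => hA _ (hP z)) (fun z => hC _ (hP z))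

theorem Matrix.PosSemidef.re_trace_mul_self_le {S : Matrix n n ℂ} (hS : S.PosSemidef) :
    (S * S).trace.re ≤ S.trace.re ^ 2 := by
  have h : (S * S).trace.re = ∑ i, ∑ j, ‖S i j‖ ^ 2 := by
    simp only [Matrix.trace, Matrix.diag, Matrix.mul_apply, Complex.re_sum]
    refine Finset.sum_congr rfl fun i _ => Finset.sum_congr rfl fun j _ => ?_
    rw [← hS.isHermitian.apply j i, Complex.star_def, Complex.mul_conj, Complex.normSq_eq_norm_sq,
      Complex.ofReal_re]
  rw [h, Matrix.trace, Complex.re_sum, sq, Finset.sum_mul_sum]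
  exact Finset.sum_le_sum fun i _ => Finset.sum_le_sum fun j _ => hS.norm_sq_apply_le i j

theorem sum_norm_sq_eq_re_trace_conjTranspose_mul (B : Matrix n n ℂ) :
    ∑ i, ∑ j, ‖B i j‖ ^ 2 = (Bᴴ * B).trace.re := by
  simp only [Matrix.trace, Matrix.diag, Matrix.mul_apply, Complex.re_sum]
  rw [Finset.sum_comm]
  refine Finset.sum_congr rfl fun j _ => Finset.sum_congr rfl fun i _ => ?_
  rw [conjTranspose_apply, Complex.star_def, ← Complex.normSq_eq_conj_mul_self,
    Complex.normSq_eq_norm_sq, Complex.ofReal_re]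

section
open scoped MatrixOrder Matrix.Norms.L2Operator

theorem Matrix.PosSemidef.exists_eq_conjTranspose_mul_self [DecidableEq n] {P : Matrix n n ℂ}
    (hP : P.PosSemidef) : ∃ Q : Matrix n n ℂ, P = Qᴴ * Q := by
  have hsqrt : (CFC.sqrt P).PosSemidef := Matrix.nonneg_iff_posSemidef.1 (CFC.sqrt_nonneg _)
  exact ⟨CFC.sqrt P, by rw [hsqrt.isHermitian, CFC.sqrt_mul_sqrt_self _ hP.nonneg]⟩

theorem sum_norm_sq_le_of_isUnit [DecidableEq n] {B : Matrix n n ℂ} (hB : IsUnit B) {t : ℝ}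
    (h : ∀ U ∈ unitary (Matrix n n ℂ), ‖(B * U).trace‖ ≤ t) :
    ∑ i, ∑ j, ‖B i j‖ ^ 2 ≤ t ^ 2 := by
  have hpos : 0 ≤ Bᴴ * B := (Matrix.posSemidef_conjTranspose_mul_self B).nonneg
  set S := CFC.sqrt (Bᴴ * B) with hS
  have hSS : S * S = Bᴴ * B := CFC.sqrt_mul_sqrt_self _ hpos
  have hSpos : S.PosSemidef := Matrix.nonneg_iff_posSemidef.1 (CFC.sqrt_nonneg _)
  have hSH : Sᴴ = S := hSpos.isHermitian
  have hSu : IsUnit S := by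
    have : IsUnit (S * S) := by
      rw [hSS]; exact ((isUnit_conjTranspose B).2 hB).mul hB
    rw [Matrix.isUnit_iff_isUnit_det] at this ⊢
    rw [Matrix.det_mul] at this
    exact isUnit_of_mul_isUnit_left this
  have hdet := (Matrix.isUnit_iff_isUnit_det S).1 hSu
  have hV : B * S⁻¹ ∈ unitary (Matrix n n ℂ) := by
    have hu : IsUnit (B * S⁻¹) := hB.mul (Matrix.isUnit_nonsing_inv_iff.2 hSu)
    refine hu.mem_unitary_of_star_mul_self ?_
    rw [Matrix.star_eq_conjTranspose, conjTranspose_mul, conjTranspose_nonsing_inv, hSH,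
      Matrix.mul_assoc, ← Matrix.mul_assoc Bᴴ, ← hSS, Matrix.mul_assoc,
      Matrix.mul_nonsing_inv _ hdet, Matrix.mul_one, Matrix.nonsing_inv_mul _ hdet]
  have htr := h _ (Unitary.star_mem hV)
  rw [Matrix.star_eq_conjTranspose, conjTranspose_mul, conjTranspose_nonsing_inv, hSH,
    Matrix.trace_mul_comm, Matrix.mul_assoc, ← hSS, ← Matrix.mul_assoc,
    Matrix.nonsing_inv_mul _ hdet, Matrix.one_mul] at htr
  rw [sum_norm_sq_eq_re_trace_conjTranspose_mul, ← hSS]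
  refine hSpos.re_trace_mul_self_le.trans ?_
  exact sq_le_sq' (neg_le_of_abs_le ((Complex.abs_re_le_norm _).trans htr))
    ((Complex.re_le_norm _).trans htr)

end

theorem sum_norm_sq_le_of_forall_unitary [DecidableEq n] {B : Matrix n n ℂ} {t : ℝ}
    (h : ∀ U ∈ unitary (Matrix n n ℂ), ‖(B * U).trace‖ ≤ t) :
    ∑ i, ∑ j, ‖B i j‖ ^ 2 ≤ t ^ 2 := by
  have hz (z : ℂ) (hz : z ∈ (spectrum ℂ B)ᶜ) :
      ∑ i, ∑ j, ‖(B - z • (1 : Matrix n n ℂ)) i j‖ ^ 2 ≤ (t + ‖z‖ * Fintype.card n) ^ 2 := by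
    apply sum_norm_sq_le_of_isUnit
    · have := spectrum.notMem_iff.1 hz
      rw [Algebra.algebraMap_eq_smul_one] at this
      simpa using this.neg
    · intro U hU
      have htrU : ‖U.trace‖ ≤ Fintype.card n := by
        refine (norm_sum_le _ _).trans ?_
        refine (Finset.sum_le_sum fun i _ => entry_norm_bound_of_unitary hU i i).trans ?_
        simp
      rw [Matrix.sub_mul, Matrix.trace_sub, Matrix.smul_mul, Matrix.one_mul, Matrix.trace_smul,
        smul_eq_mul]
      refine (norm_sub_le _ _).trans (add_le_add (h U hU) ?_)
      rw [norm_mul]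
      gcongr
  have hclosed : IsClosed {z : ℂ | ∑ i, ∑ j, ‖(B - z • (1 : Matrix n n ℂ)) i j‖ ^ 2 ≤
      (t + ‖z‖ * Fintype.card n) ^ 2} := by
    apply isClosed_le
    · simp only [Matrix.sub_apply, Matrix.smul_apply]
      fun_prop
    · fun_prop
  have hdense : Dense (spectrum ℂ B)ᶜ :=
    (Matrix.finite_spectrum B).countable.dense_compl ℝ
  have h0 : (0 : ℂ) ∈ closure (spectrum ℂ B)ᶜ := hdense 0
  simpa using hclosed.closure_subset_iff.2 hz h0

/-- A matrix on a tensor product is block positive if its quadratic form is nonnegative on simple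
tensors. -/
def IsBlockPositive (W : Matrix (m × n) (m × n) ℂ) : Prop :=
  W.IsHermitian ∧ ∀ (a : m → ℂ) (b : n → ℂ),
    0 ≤ (star (fun p : m × n => a p.1 * b p.2) ⬝ᵥ W *ᵥ (fun p => a p.1 * b p.2)).re

/-- The `(i, j)` block of a matrix on a tensor product. -/
def tensorBlock (W : Matrix (m × n) (m × n) ℂ) (i j : m) : Matrix n n ℂ :=
  Matrix.of fun s t => W (i, s) (j, t)

theorem star_dotProduct_tensorBlock_trace (W : Matrix (m × n) (m × n) ℂ) {Q : Matrix n n ℂ}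
    (a : m → ℂ) :
    star a ⬝ᵥ (Matrix.of fun i j => (tensorBlock W i j * (Qᴴ * Q)).trace) *ᵥ a =
      ∑ l, star (fun p : m × n => a p.1 * star (Q l p.2)) ⬝ᵥ
        W *ᵥ (fun p => a p.1 * star (Q l p.2)) := by
  simp only [dotProduct, mulVec, tensorBlock, Matrix.trace, Matrix.diag, Matrix.mul_apply,
    Matrix.of_apply, conjTranspose_apply, Fintype.sum_prod_type, Pi.star_apply, Finset.mul_sum,
    Finset.sum_mul, star_mul', star_star]
  symm
  rw [Finset.sum_comm]
  refine Finset.sum_congr rfl fun i _ => ?_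
  rw [Finset.sum_congr rfl fun l _ => Finset.sum_comm, Finset.sum_comm]
  refine Finset.sum_congr rfl fun j _ => ?_
  rw [Finset.sum_comm]
  refine Finset.sum_congr rfl fun s _ => ?_
  rw [Finset.sum_comm]
  refine Finset.sum_congr rfl fun t _ => Finset.sum_congr rfl fun l _ => ?_
  ring

namespace IsBlockPositive

theorem isHermitian_tensorBlock_trace {W : Matrix (m × n) (m × n) ℂ}
    (hW : IsBlockPositive W) {P : Matrix n n ℂ} (hP : P.IsHermitian) :
    (Matrix.of fun i j => (tensorBlock W i j * P).trace).IsHermitian := by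
  ext i j
  have hblock : (tensorBlock W j i)ᴴ = tensorBlock W i j := by
    ext s t
    exact hW.1.apply _ _
  rw [conjTranspose_apply, of_apply, of_apply, ← Matrix.trace_conjTranspose, conjTranspose_mul,
    hP, Matrix.trace_mul_comm, hblock]

theorem posSemidef_tensorBlock_trace [DecidableEq n] {W : Matrix (m × n) (m × n) ℂ}
    (hW : IsBlockPositive W) {P : Matrix n n ℂ} (hP : P.PosSemidef) :
    (Matrix.of fun i j => (tensorBlock W i j * P).trace).PosSemidef := by
  obtain ⟨Q, rfl⟩ := hP.exists_eq_conjTranspose_mul_self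
  have hH := hW.isHermitian_tensorBlock_trace hP.isHermitian
  refine Matrix.PosSemidef.of_dotProduct_mulVec_nonneg hH fun a => ?_
  have him := hH.im_star_dotProduct_mulVec_self a
  have hre : 0 ≤ (star a ⬝ᵥ (Matrix.of fun i j => (tensorBlock W i j * (Qᴴ * Q)).trace) *ᵥ a).re := by
    rw [star_dotProduct_tensorBlock_trace, Complex.re_sum]
    exact Finset.sum_nonneg fun l _ => hW.2 a fun t => star (Q l t)
  exact Complex.le_def.2 ⟨hre, him.symm⟩

theorem re_trace_tensorBlock_mul_nonneg [DecidableEq n] {W : Matrix (m × n) (m × n) ℂ}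
    (hW : IsBlockPositive W) (i : m) {P : Matrix n n ℂ} (hP : P.PosSemidef) :
    0 ≤ (tensorBlock W i i * P).trace.re :=
  (Complex.le_def.1 ((hW.posSemidef_tensorBlock_trace hP).diag_nonneg (i := i))).1

theorem re_trace_tensorBlock_nonneg [DecidableEq n] {W : Matrix (m × n) (m × n) ℂ}
    (hW : IsBlockPositive W) (i : m) : 0 ≤ (tensorBlock W i i).trace.re := by
  simpa using hW.re_trace_tensorBlock_mul_nonneg i Matrix.PosSemidef.one

theorem re_trace_eq_sum (W : Matrix (m × n) (m × n) ℂ) :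
    W.trace.re = ∑ i, (tensorBlock W i i).trace.re := by
  simp [Matrix.trace, tensorBlock, Fintype.sum_prod_type]

theorem re_trace_nonneg [DecidableEq n] {W : Matrix (m × n) (m × n) ℂ}
    (hW : IsBlockPositive W) : 0 ≤ W.trace.re := by
  rw [re_trace_eq_sum]
  exact Finset.sum_nonneg fun i _ => hW.re_trace_tensorBlock_nonneg i

theorem sum_norm_sq_le [DecidableEq n] {W : Matrix (m × n) (m × n) ℂ} (hW : IsBlockPositive W) :
    ∑ p, ∑ q, ‖W p q‖ ^ 2 ≤ W.trace.re ^ 2 := by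
  have hblock (i j : m) : ∑ s, ∑ t, ‖W (i, s) (j, t)‖ ^ 2 ≤
      (tensorBlock W i i).trace.re * (tensorBlock W j j).trace.re := by
    have := sum_norm_sq_le_of_forall_unitary (B := tensorBlock W i j) fun U hU =>
      norm_trace_mul_le_of_mem_unitary (fun P hP => hW.re_trace_tensorBlock_mul_nonneg i hP)
        (fun P hP => hW.re_trace_tensorBlock_mul_nonneg j hP)
        (fun P hP => (hW.posSemidef_tensorBlock_trace hP).norm_sq_apply_le i j) hU
    rwa [mul_pow, Real.sq_sqrt (hW.re_trace_tensorBlock_nonneg i),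
      Real.sq_sqrt (hW.re_trace_tensorBlock_nonneg j)] at this
  rw [re_trace_eq_sum, sq, Finset.sum_mul_sum]
  simp only [Fintype.sum_prod_type]
  refine Finset.sum_le_sum fun i _ => ?_
  rw [Finset.sum_comm]
  exact Finset.sum_le_sum fun j _ => hblock i j

theorem re_trace_mul_one_add_nonneg [DecidableEq m] [DecidableEq n]
    {W X : Matrix (m × n) (m × n) ℂ} (hW : IsBlockPositive W) (hX : X.IsHermitian)
    (hX1 : (X * X).trace.re ≤ 1) : 0 ≤ (W * (1 + X)).trace.re := by
  have hXn : ∑ p, ∑ q, ‖X p q‖ ^ 2 ≤ 1 := by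
    rwa [sum_norm_sq_eq_re_trace_conjTranspose_mul, hX]
  have hle : ‖(W * X).trace‖ ≤ ∑ r : (m × n) × (m × n), ‖W r.1 r.2‖ * ‖X r.2 r.1‖ := by
    rw [Fintype.sum_prod_type (α₁ := m × n)]
    refine (norm_sum_le _ _).trans (Finset.sum_le_sum fun p _ => ?_)
    rw [Matrix.diag_apply, Matrix.mul_apply]
    exact (norm_sum_le _ _).trans_eq (Finset.sum_congr rfl fun q _ => norm_mul _ _)
  have hsq : ‖(W * X).trace‖ ^ 2 ≤ W.trace.re ^ 2 := calc
    ‖(W * X).trace‖ ^ 2 ≤ (∑ r : (m × n) × (m × n), ‖W r.1 r.2‖ * ‖X r.2 r.1‖) ^ 2 := by gcongr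
    _ ≤ (∑ r : (m × n) × (m × n), ‖W r.1 r.2‖ ^ 2) *
        ∑ r : (m × n) × (m × n), ‖X r.2 r.1‖ ^ 2 := Finset.sum_mul_sq_le_sq_mul_sq _ _ _
    _ ≤ W.trace.re ^ 2 * 1 := by
        rw [Fintype.sum_prod_type (α₁ := m × n), Fintype.sum_prod_type_right (α₂ := m × n)]
        exact mul_le_mul hW.sum_norm_sq_le hXn (by positivity) (by positivity)
    _ = W.trace.re ^ 2 := mul_one _
  have habs := abs_le_of_sq_le_sq' hsq hW.re_trace_nonneg
  have hre := Complex.abs_re_le_norm (W * X).trace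
  rw [mul_add, mul_one, Matrix.trace_add, Complex.add_re]
  linarith [neg_abs_le (W * X).trace.re]

end IsBlockPositive

theorem star_dotProduct_mulVec_eq_trace_mul_pureState (W : Matrix n n ℂ) (ψ : n → ℂ) :
    star ψ ⬝ᵥ W *ᵥ ψ = (W * pureState ψ).trace := by
  rw [pureState, Matrix.mul_vecMulVec, Matrix.trace_vecMulVec, dotProduct_comm]

theorem isHermitian_pureState (ψ : n → ℂ) : (pureState ψ).IsHermitian := by
  ext i j
  simp [pureState, vecMulVec_apply, mul_comm]

theorem trace_pureState {ψ : n → ℂ} (hψ : IsUnitVec ψ) : (pureState ψ).trace = 1 := by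
  have : (pureState ψ).trace = ((∑ p, Complex.normSq (ψ p) : ℝ) : ℂ) := by
    simp [pureState, Matrix.trace, vecMulVec_apply, Complex.mul_conj]
  rw [this, hψ, Complex.ofReal_one]

/-- The simple tensor of two vectors. -/
def simpleTensor (a : m → ℂ) (b : n → ℂ) : m × n → ℂ := fun p => a p.1 * b p.2

variable (m n) in
/-- The pure product states. -/
def pureProductStates : Set (Matrix (m × n) (m × n) ℂ) :=
  {M | ∃ (a : m → ℂ) (b : n → ℂ), IsUnitVec a ∧ IsUnitVec b ∧ M = pureState (simpleTensor a b)}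

theorem IsUnitVec.simpleTensor {a : m → ℂ} {b : n → ℂ} (ha : IsUnitVec a) (hb : IsUnitVec b) :
    IsUnitVec (simpleTensor a b) := by
  unfold IsUnitVec at *
  simp only [_root_.simpleTensor, Complex.normSq_mul, Fintype.sum_prod_type, ← Finset.mul_sum, hb,
    mul_one, ha]

theorem exists_smul_isUnitVec (a : n → ℂ) (ha : a ≠ 0) :
    ∃ (c : ℝ) (a' : n → ℂ), IsUnitVec a' ∧ a = (c : ℂ) • a' := by
  have hpos : 0 < ∑ i, Complex.normSq (a i) := by
    obtain ⟨i, hi⟩ := Function.ne_iff.1 ha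
    exact Finset.sum_pos' (fun i _ => Complex.normSq_nonneg _)
      ⟨i, Finset.mem_univ i, Complex.normSq_pos.2 hi⟩
  set c := √(∑ i, Complex.normSq (a i)) with hc
  have hc0 : c ≠ 0 := (Real.sqrt_pos.2 hpos).ne'
  have hcc : c * c = ∑ i, Complex.normSq (a i) := Real.mul_self_sqrt hpos.le
  refine ⟨c, (c : ℂ)⁻¹ • a, ?_, ?_⟩
  · simp only [IsUnitVec, Pi.smul_apply, smul_eq_mul, Complex.normSq_mul, ← Finset.mul_sum, ← hcc,
      Complex.normSq_inv, Complex.normSq_ofReal]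
    field_simp
  · rw [smul_inv_smul₀ (Complex.ofReal_ne_zero.2 hc0)]

theorem isCompact_setOf_isUnitVec : IsCompact {a : n → ℂ | IsUnitVec a} := by
  refine (isCompact_closedBall (0 : n → ℂ) 1).of_isClosed_subset ?_ ?_
  · exact isClosed_eq (continuous_finsetSum _ fun i _ =>
      Complex.continuous_normSq.comp (continuous_apply i)) continuous_const
  · intro a ha
    rw [mem_closedBall_zero_iff, pi_norm_le_iff_of_nonneg zero_le_one]
    intro i
    rw [← sq_le_one_iff₀ (norm_nonneg _), ← Complex.normSq_eq_norm_sq]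
    exact (Finset.single_le_sum (f := fun i => Complex.normSq (a i))
      (fun i _ => Complex.normSq_nonneg _) (Finset.mem_univ i)).trans_eq ha

theorem isCompact_pureProductStates : IsCompact (pureProductStates m n) := by
  have : pureProductStates m n = (fun q : (m → ℂ) × (n → ℂ) => pureState (simpleTensor q.1 q.2)) ''
      ({a | IsUnitVec a} ×ˢ {b | IsUnitVec b}) := by
    ext M
    constructor
    · rintro ⟨a, b, ha, hb, rfl⟩
      exact ⟨(a, b), ⟨ha, hb⟩, rfl⟩
    · rintro ⟨⟨a, b⟩, ⟨ha, hb⟩, rfl⟩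
      exact ⟨a, b, ha, hb, rfl⟩
  rw [this]
  refine (isCompact_setOf_isUnitVec.prod isCompact_setOf_isUnitVec).image ?_
  refine continuous_matrix fun p q => ?_
  simp only [pureState, vecMulVec_apply, simpleTensor, Pi.star_apply]
  fun_prop

instance Matrix.instLocallyConvexSpaceReal {m n : Type*} :
    LocallyConvexSpace ℝ (Matrix m n ℂ) :=
  inferInstanceAs (LocallyConvexSpace ℝ (m → n → ℂ))

theorem Matrix.exists_eq_trace_mul [DecidableEq n] (g : Matrix n n ℂ →ₗ[ℂ] ℂ) :
    ∃ G : Matrix n n ℂ, ∀ M, g M = (G * M).trace := by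
  refine ⟨Matrix.of fun q p => g (Matrix.single p q 1), fun M => ?_⟩
  have hM : M = ∑ p, ∑ q, M p q • Matrix.single p q (1 : ℂ) := by
    conv_lhs => rw [Matrix.matrix_eq_sum_single M]
    simp
  conv_lhs => rw [hM]
  simp only [map_sum, map_smul, smul_eq_mul, Matrix.trace, Matrix.diag, Matrix.mul_apply, of_apply]
  rw [Finset.sum_comm]
  simp only [mul_comm]

/-- A Hermitian matrix of unit trace lies in the convex hull of the pure product states if no block
positive matrix separates it from them. -/
theorem mem_convexHull_pureProductStates [DecidableEq m] [DecidableEq n]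
    {ρ : Matrix (m × n) (m × n) ℂ} (hρ : ρ.IsHermitian) (htr : ρ.trace = 1)
    (h : ∀ W : Matrix (m × n) (m × n) ℂ, IsBlockPositive W → 0 ≤ (W * ρ).trace.re) :
    ρ ∈ convexHull ℝ (pureProductStates m n) := by
  by_contra hmem
  obtain ⟨f, u, hfρ, hfu⟩ := geometric_hahn_banach_point_closed (convex_convexHull ℝ _)
    (IsCompact.convexHull_of_finiteDimensional isCompact_pureProductStates).isClosed hmem
  obtain ⟨G, hG⟩ := Matrix.exists_eq_trace_mul
    (Module.Dual.extendRCLike (𝕜 := ℂ) (f : Matrix (m × n) (m × n) ℂ →ₗ[ℝ] ℝ))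
  have hfG (M : Matrix (m × n) (m × n) ℂ) : f M = (G * M).trace.re := by
    rw [← hG]
    exact (Module.Dual.re_extendRCLike_apply (𝕜 := ℂ)
      (f : Matrix (m × n) (m × n) ℂ →ₗ[ℝ] ℝ) M).symm
  set W : Matrix (m × n) (m × n) ℂ := (2⁻¹ : ℝ) • (G + Gᴴ) - u • 1 with hWdef
  have hfW (M : Matrix (m × n) (m × n) ℂ) (hM : M.IsHermitian) :
      (W * M).trace.re = f M - u * M.trace.re := by
    have hGM : (Gᴴ * M).trace.re = (G * M).trace.re := by
      conv_lhs => rw [← hM, ← conjTranspose_mul, Matrix.trace_conjTranspose, Matrix.trace_mul_comm]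
      simp
    rw [hWdef, hfG, Matrix.sub_mul, Matrix.smul_mul, Matrix.smul_mul, Matrix.one_mul,
      Matrix.trace_sub, Matrix.trace_smul, Matrix.trace_smul, Matrix.add_mul, Matrix.trace_add,
      Complex.sub_re, Complex.smul_re, Complex.smul_re, Complex.add_re, hGM, smul_eq_mul,
      smul_eq_mul]
    ring
  have hWH : W.IsHermitian := by
    rw [hWdef]
    refine Matrix.IsHermitian.sub ?_ ?_
    · rw [Matrix.IsHermitian, conjTranspose_smul, conjTranspose_add, conjTranspose_conjTranspose,
        add_comm, star_trivial]
    · rw [Matrix.IsHermitian, conjTranspose_smul, conjTranspose_one, star_trivial]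
  have hW : IsBlockPositive W := by
    refine ⟨hWH, fun a b => ?_⟩
    rcases eq_or_ne a 0 with rfl | ha
    · simp [dotProduct]
    rcases eq_or_ne b 0 with rfl | hb
    · simp [dotProduct]
    obtain ⟨c, a, hau, rfl⟩ := exists_smul_isUnitVec a ha
    obtain ⟨e, b, hbu, rfl⟩ := exists_smul_isUnitVec b hb
    have hψ : (fun p : m × n => ((c : ℂ) • a) p.1 * ((e : ℂ) • b) p.2) =
        (c * e : ℝ) • simpleTensor a b := by
      ext p
      simp [simpleTensor]
      ring
    rw [hψ, Matrix.mulVec_smul, star_smul, smul_dotProduct, dotProduct_smul,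
      star_dotProduct_mulVec_eq_trace_mul_pureState, star_trivial, Complex.smul_re, Complex.smul_re,
      hfW _ (isHermitian_pureState _), trace_pureState (hau.simpleTensor hbu), smul_eq_mul,
      smul_eq_mul, ← mul_assoc]
    have := hfu _ (subset_convexHull ℝ _ ⟨a, b, hau, hbu, rfl⟩)
    refine mul_nonneg (mul_self_nonneg _) ?_
    simp
    exact this.le
  have := h W hW
  rw [hfW ρ hρ, htr] at this
  simp at this
  linarith

theorem pureProductStates_subset_Ek {d₁ d₂ k : ℕ} (hk : 1 ≤ k) :
    pureProductStates (Fin d₁) (Fin d₂) ⊆ Ek d₁ d₂ k := by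
  rintro _ ⟨a, b, ha, hb, rfl⟩
  refine ⟨simpleTensor a b, ha.simpleTensor hb, ⟨Pi.single ⟨0, hk⟩ a, fun _ => b, fun p => ?_⟩, rfl⟩
  rw [Finset.sum_eq_single ⟨0, hk⟩ (by simp +contextual) (by simp)]
  simp [simpleTensor]

theorem sq_le_of_hsNorm_le {A : Matrix n n ℂ} {D : ℝ} (hD : 0 < D) (h : hsNorm A ≤ 1 / √D) :
    (A * A).trace.re ≤ 1 / D := by
  rw [hsNorm, ← Real.sqrt_one, ← Real.sqrt_div zero_le_one] at h
  exact (Real.sqrt_le_sqrt_iff (by positivity)).1 h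

theorem one_add_mem_convexHull_pureProductStates [DecidableEq m] [DecidableEq n] {d : ℝ}
    (hd : d = Fintype.card (m × n)) (hd1 : 1 < d) {A : Matrix (m × n) (m × n) ℂ}
    (hA : A.IsHermitian) (htr : A.trace = 0) (hnorm : (A * A).trace.re ≤ 1 / (d * (d - 1))) :
    (d : ℂ)⁻¹ • 1 + A ∈ convexHull ℝ (pureProductStates m n) := by
  have hdc : (Fintype.card (m × n) : ℂ) = (d : ℂ) := by rw [hd]; simp
  have hd0 : (d : ℂ) ≠ 0 := Complex.ofReal_ne_zero.2 (by linarith)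
  set X : Matrix (m × n) (m × n) ℂ := (d - 1) • A - d⁻¹ • 1 with hX
  have hXH : X.IsHermitian := by
    rw [hX]
    refine Matrix.IsHermitian.sub ?_ ?_
    · rw [Matrix.IsHermitian, conjTranspose_smul, hA, star_trivial]
    · rw [Matrix.IsHermitian, conjTranspose_smul, conjTranspose_one, star_trivial]
  have hXX : (X * X).trace.re ≤ 1 := by
    have hval : (X * X).trace.re = (d - 1) ^ 2 * (A * A).trace.re + d⁻¹ := by
      rw [hX]
      simp only [Matrix.sub_mul, Matrix.mul_sub, Matrix.smul_mul, Matrix.mul_smul, Matrix.one_mul,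
        Matrix.mul_one, Matrix.trace_sub, Matrix.trace_smul, htr, Matrix.trace_one, hdc,
        Complex.sub_re, Complex.smul_re, Complex.ofReal_re, Complex.zero_re, smul_eq_mul]
      field_simp
      ring
    rw [hval]
    calc (d - 1) ^ 2 * (A * A).trace.re + d⁻¹ ≤ (d - 1) ^ 2 * (1 / (d * (d - 1))) + d⁻¹ := by gcongr
      _ = 1 := by
        have : d - 1 ≠ 0 := by linarith
        field_simp
        ring
  refine mem_convexHull_pureProductStates ?_ ?_ fun W hW => ?_
  · refine Matrix.IsHermitian.add ?_ hA
    rw [Matrix.IsHermitian, conjTranspose_smul, conjTranspose_one]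
    simp
  · rw [Matrix.trace_add, htr, Matrix.trace_smul, Matrix.trace_one, hdc, add_zero, smul_eq_mul,
      inv_mul_cancel₀ hd0]
  · have hpos := hW.re_trace_mul_one_add_nonneg hXH hXX
    have hone : 1 + X = (d - 1) • ((d : ℂ)⁻¹ • 1 + A) := by
      rw [hX]
      ext p q
      simp only [Matrix.add_apply, Matrix.sub_apply, Matrix.smul_apply, smul_eq_mul,
        Complex.real_smul]
      push_cast
      field_simp
      ring
    rw [hone, Matrix.mul_smul, Matrix.trace_smul, Complex.smul_re, smul_eq_mul] at hpos
    exact nonneg_of_mul_nonneg_right hpos (by linarith)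

theorem re_diag_nonneg_of_mem_convexHull_Ek {d₁ d₂ k : ℕ}
    {M : Matrix (Fin d₁ × Fin d₂) (Fin d₁ × Fin d₂) ℂ} (hM : M ∈ convexHull ℝ (Ek d₁ d₂ k))
    (p : Fin d₁ × Fin d₂) : 0 ≤ (M p p).re := by
  refine convexHull_min (t := {M | 0 ≤ (M p p).re}) ?_ ?_ hM
  · rintro _ ⟨ψ, -, -, rfl⟩
    simp only [pureState, vecMulVec_apply, Pi.star_apply, Complex.star_def, Complex.mul_conj,
      Set.mem_ofPred_eq, Complex.ofReal_re]
    exact Complex.normSq_nonneg _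
  · intro M hM N hN a b ha hb _
    simp only [Set.mem_ofPred_eq, Matrix.add_apply, Matrix.smul_apply, Complex.add_re,
      Complex.smul_re, smul_eq_mul] at *
    positivity

/-- The traceless matrix `s • (I / d - |p⟩⟨p|)`. -/
def diagonalWitness [DecidableEq n] (d s : ℝ) (p : n) : Matrix n n ℂ :=
  Matrix.diagonal fun q => ((s * (d⁻¹ - if q = p then 1 else 0) : ℝ) : ℂ)

theorem isHermitian_diagonalWitness {n : Type*} [DecidableEq n] (d s : ℝ) (p : n) :
    (diagonalWitness d s p).IsHermitian :=
  Matrix.isHermitian_diagonal_of_self_adjoint _ (by ext q; simp)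

theorem trace_diagonalWitness [DecidableEq n] {d : ℝ} (hd : d = Fintype.card n) (hd0 : d ≠ 0)
    (s : ℝ) (p : n) : (diagonalWitness d s p).trace = 0 := by
  rw [diagonalWitness, Matrix.trace_diagonal, ← Complex.ofReal_sum, ← Finset.mul_sum,
    Finset.sum_sub_distrib]
  simp [← hd, hd0]

theorem hsNorm_diagonalWitness [DecidableEq n] {d : ℝ} (hd : d = Fintype.card n) (hd0 : d ≠ 0)
    (s : ℝ) (p : n) : hsNorm (diagonalWitness d s p) = √(s ^ 2 * ((d - 1) / d)) := by
  rw [hsNorm, diagonalWitness, Matrix.diagonal_mul_diagonal, Matrix.trace_diagonal]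
  simp only [← Complex.ofReal_mul, ← Complex.ofReal_sum, Complex.ofReal_re]
  congr 1
  have h (q : n) : s * (d⁻¹ - if q = p then 1 else 0) * (s * (d⁻¹ - if q = p then 1 else 0)) =
      s ^ 2 * (d⁻¹ ^ 2 + (1 - 2 * d⁻¹) * if q = p then 1 else 0) := by
    split_ifs <;> ring
  simp only [h, ← Finset.mul_sum, Finset.sum_add_distrib]
  have hsum : ∑ q, (if q = p then (1 : ℝ) else 0) = 1 := by simp
  rw [hsum, Finset.sum_const, Finset.card_univ, nsmul_eq_mul, ← hd]
  field_simp
  ring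

end

/-- for `d₁ ≥ d₂ > 1`, `d = d₁ d₂` and `1 ≤ k ≤ d₂`, the largest ball
centered at `𝕀_H = I/d` contained in the convex hull of the `k`-entangled pure states has
radius `1/√(d(d-1))` (the same as the largest such ball inside all density states):
every traceless Hermitian `A` with `‖A‖ ≤ 1/√(d(d-1))` satisfies
`𝕀_H + A ∈ Conv(E_k)`, and conversely any radius `r` whose ball is contained in
`Conv(E_k)` satisfies `r ≤ 1/√(d(d-1))`. -/
theorem stmt9 (d₁ d₂ k : ℕ) (hd : d₂ ≤ d₁) (h2 : 1 < d₂) (hk1 : 1 ≤ k) (hk2 : k ≤ d₂) :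
    (∀ A : Matrix (Fin d₁ × Fin d₂) (Fin d₁ × Fin d₂) ℂ,
        A.IsHermitian → A.trace = 0 →
        hsNorm A ≤ 1 / Real.sqrt ((d₁ * d₂ : ℝ) * ((d₁ * d₂ : ℝ) - 1)) →
        (((d₁ * d₂ : ℕ) : ℂ))⁻¹ • 1 + A ∈ convexHull ℝ (Ek d₁ d₂ k)) ∧
    (∀ r : ℝ,
      (∀ A : Matrix (Fin d₁ × Fin d₂) (Fin d₁ × Fin d₂) ℂ,
        A.IsHermitian → A.trace = 0 → hsNorm A ≤ r →
        (((d₁ * d₂ : ℕ) : ℂ))⁻¹ • 1 + A ∈ convexHull ℝ (Ek d₁ d₂ k)) →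
      r ≤ 1 / Real.sqrt ((d₁ * d₂ : ℝ) * ((d₁ * d₂ : ℝ) - 1))) := by
  have h1 : (1 : ℝ) < (d₁ * d₂ : ℝ) := by
    exact_mod_cast (by nlinarith : 1 < d₁ * d₂)
  have hcard : (d₁ * d₂ : ℝ) = Fintype.card (Fin d₁ × Fin d₂) := by simp
  have hcast : ((d₁ * d₂ : ℕ) : ℂ) = ((d₁ * d₂ : ℝ) : ℂ) := by push_cast; rfl
  rw [hcast]
  set d : ℝ := d₁ * d₂ with hd'
  have hd0 : 0 < d := by linarith
  have hD : 0 < d * (d - 1) := mul_pos hd0 (by linarith)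
  refine ⟨fun A hA htr hnorm => ?_, fun r hr => ?_⟩
  · exact convexHull_mono (pureProductStates_subset_Ek hk1)
      (one_add_mem_convexHull_pureProductStates hcard h1 hA htr (sq_le_of_hsNorm_le hD hnorm))
  · rcases lt_or_ge r 0 with hr0 | hr0
    · exact hr0.le.trans (by positivity)
    have hd1 : 0 < d - 1 := by linarith
    have p : Fin d₁ × Fin d₂ := (⟨0, by omega⟩, ⟨0, by omega⟩)
    set s : ℝ := r * √(d / (d - 1)) with hs
    have hs2 : s ^ 2 * ((d - 1) / d) = r ^ 2 := by
      rw [hs, mul_pow, Real.sq_sqrt (by positivity)]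
      field_simp
    have hmem := hr (diagonalWitness d s p) (isHermitian_diagonalWitness d s p)
      (trace_diagonalWitness hcard hd0.ne' s p)
      (by rw [hsNorm_diagonalWitness hcard hd0.ne', hs2, Real.sqrt_sq hr0])
    have hpp := re_diag_nonneg_of_mem_convexHull_Ek hmem p
    have hval : (((d : ℂ)⁻¹ • (1 : Matrix (Fin d₁ × Fin d₂) (Fin d₁ × Fin d₂) ℂ) +
        diagonalWitness d s p) p p).re = d⁻¹ + s * (d⁻¹ - 1) := by
      rw [Matrix.add_apply, Matrix.smul_apply, Matrix.one_apply_eq, diagonalWitness,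
        Matrix.diagonal_apply_eq, if_pos rfl, smul_eq_mul, mul_one, ← Complex.ofReal_inv,
        ← Complex.ofReal_add, Complex.ofReal_re]
    rw [hval] at hpp
    have hs1 : s * (d - 1) ≤ 1 := by
      have := mul_nonneg hd0.le hpp
      field_simp at this
      linarith
    have hs0 : 0 ≤ s := by positivity
    have hr2 : r ^ 2 ≤ 1 / (d * (d - 1)) := by
      rw [← hs2, le_div_iff₀ hD]
      calc s ^ 2 * ((d - 1) / d) * (d * (d - 1)) = (s * (d - 1)) ^ 2 := by field_simp
        _ ≤ 1 := pow_le_one₀ (by positivity) hs1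
    rw [one_div, ← Real.sqrt_inv, ← one_div]
    exact Real.le_sqrt_of_sq_le hr2

end
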